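/- Let T > 1, K > 1, t ∈ (0, T], x ∈ [−K, K], and h ∈ (0, 1], and set F(r,z) = ρ(t+h−r, x−z)·ρ(r,z)/ρ(t+h, x) − ρ(t−r, x−z)·ρ(r,z)/ρ(t, x). Then (i) ∫₀ᵗ ∫_ℝ F(r,z)² dz dr ≤ 10·T^{3/2}·K²·h^{1/7}; and (ii) if in addition δ ∈ (0,1) and t ≥ δ and t + h ≤ T, then ∫₀ᵗ ∫_ℝ F(r,z)² dz dr ≤ (10/δ³)·T^{3/2}·K²·√h. -/

import Mathlib

open MeasureTheory

/-- The one-dimensional heat kernel `ρ(t,x) = (2πt)^{-1/2} exp(-x²/(2t))` for `t > 0`,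
extended by `0` for `t ≤ 0`. -/
noncomputable def heatKer (t x : ℝ) : ℝ :=
  if 0 < t then Real.exp (-x ^ 2 / (2 * t)) / Real.sqrt (2 * Real.pi * t) else 0

lemma hk_pos_def {v : ℝ} (hv : 0 < v) (x : ℝ) :
    heatKer v x = Real.exp (-x ^ 2 / (2 * v)) / Real.sqrt (2 * Real.pi * v) := by
  simp [heatKer, hv]

lemma hk_pos {v : ℝ} (hv : 0 < v) (x : ℝ) : 0 < heatKer v x := by
  rw [hk_pos_def hv]
  have := Real.pi_pos
  positivity

lemma hk_neg (v x y : ℝ) : heatKer v (x - y) = heatKer v (y - x) := by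
  unfold heatKer
  rw [show (x - y) ^ 2 = (y - x) ^ 2 by ring]

lemma hk_mul {v w : ℝ} (hv : 0 < v) (hw : 0 < w) (m n z : ℝ) :
    heatKer v (z - m) * heatKer w (z - n) =
      heatKer (v + w) (m - n) * heatKer (v * w / (v + w)) (z - (m * w + n * v) / (v + w)) := by
  have hp := Real.pi_pos
  have hvw : 0 < v + w := by positivity
  rw [hk_pos_def hv, hk_pos_def hw, hk_pos_def hvw, hk_pos_def (by positivity),
    div_mul_div_comm, div_mul_div_comm, ← Real.exp_add, ← Real.exp_add,
    ← Real.sqrt_mul (by positivity), ← Real.sqrt_mul (by positivity)]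
  congr 2
  · field_simp
    ring
  · field_simp

lemma hk_integral {v : ℝ} (hv : 0 < v) (m : ℝ) : ∫ z : ℝ, heatKer v (z - m) = 1 := by
  have hp := Real.pi_pos
  rw [integral_sub_right_eq_self (fun z => heatKer v z) m]
  simp_rw [hk_pos_def hv]
  rw [integral_div]
  have := integral_gaussian (1 / (2 * v))
  rw [show (fun z : ℝ => Real.exp (-z ^ 2 / (2 * v))) =
    fun z => Real.exp (-(1 / (2 * v)) * z ^ 2) by ext z; congr 1; ring, this,
    show Real.pi / (1 / (2 * v)) = 2 * Real.pi * v by field_simp]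
  exact div_self (by positivity)

lemma hk_integrable {v : ℝ} (hv : 0 < v) (m : ℝ) : Integrable (fun z : ℝ => heatKer v (z - m)) :=
  Integrable.of_integral_ne_zero (by rw [hk_integral hv]; exact one_ne_zero)

lemma hk_prod_integral {v w : ℝ} (hv : 0 < v) (hw : 0 < w) (m n : ℝ) :
    Integrable (fun z : ℝ => heatKer v (z - m) * heatKer w (z - n)) ∧
    ∫ z : ℝ, heatKer v (z - m) * heatKer w (z - n) = heatKer (v + w) (m - n) := by
  simp_rw [hk_mul hv hw]
  have h : 0 < v * w / (v + w) := by positivity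
  refine ⟨(hk_integrable h _).const_mul _, ?_⟩
  rw [integral_const_mul, hk_integral h, mul_one]

lemma bridge {s r : ℝ} (hr : 0 < r) (hs : r < s) (x z : ℝ) :
    heatKer (s - r) (x - z) * heatKer r z / heatKer s x =
      heatKer (r * (s - r) / s) (z - x * r / s) := by
  have h0 : 0 < s := by linarith
  have h := hk_mul (sub_pos.2 hs) hr x 0 z
  rw [hk_neg]
  rw [sub_zero, sub_add_cancel, sub_zero] at h
  rw [h, mul_div_cancel_left₀ _ (hk_pos h0 x).ne']
  congr 1
  · ring
  · ring

lemma inner_eq {t h r : ℝ} (hr : 0 < r) (hrt : r < t) (hh : 0 < h) (x : ℝ) :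
    ∫ z : ℝ, (heatKer (t + h - r) (x - z) * heatKer r z / heatKer (t + h) x -
          heatKer (t - r) (x - z) * heatKer r z / heatKer t x) ^ 2 =
    heatKer (2 * (r * (t + h - r) / (t + h))) 0 + heatKer (2 * (r * (t - r) / t)) 0
     - 2 * heatKer (r * (t + h - r) / (t + h) + r * (t - r) / t)
        (x * r / (t + h) - x * r / t) := by
  have ht : 0 < t := by linarith
  have h1 : 0 < t - r := by linarith
  have h2 : 0 < t + h - r := by linarith
  simp_rw [bridge hr hrt, bridge hr (show r < t + h by linarith)]
  set v := r * (t + h - r) / (t + h) with hv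
  set w := r * (t - r) / t with hw
  have hv0 : 0 < v := by positivity
  have hw0 : 0 < w := by positivity
  set m := x * r / (t + h)
  set n := x * r / t
  obtain ⟨i1, e1⟩ := hk_prod_integral hv0 hv0 m m
  obtain ⟨i2, e2⟩ := hk_prod_integral hw0 hw0 n n
  obtain ⟨i3, e3⟩ := hk_prod_integral hv0 hw0 m n
  have : ∀ z, (heatKer v (z - m) - heatKer w (z - n)) ^ 2 =
    heatKer v (z - m) * heatKer v (z - m) + heatKer w (z - n) * heatKer w (z - n)
      - 2 * (heatKer v (z - m) * heatKer w (z - n)) := fun z => by ring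
  simp_rw [this]
  rw [integral_sub (by exact i1.add i2) (i3.const_mul 2), integral_add i1 i2, integral_const_mul,
    e1, e2, e3, sub_self, sub_self, two_mul v, two_mul w]

lemma hk_zero {v : ℝ} (hv : 0 < v) : heatKer (2 * v) 0 = 1 / (2 * √Real.pi) * (1 / √v) := by
  have hp := Real.pi_pos
  rw [hk_pos_def (by positivity), show 2 * Real.pi * (2 * v) = 2 ^ 2 * (Real.pi * v) by ring,
    Real.sqrt_mul (by positivity), Real.sqrt_mul hp.le, Real.sqrt_sq (by norm_num)]
  simp
  ring

lemma one_sub_exp_le {u : ℝ} (hu : 0 ≤ u) : 1 - Real.exp (-u) ≤ min 1 (√u) := by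
  have h1 := Real.exp_pos (-u)
  have h2 := Real.add_one_le_exp (-u)
  refine le_min (by linarith) ?_
  rcases le_total u 1 with h | h
  · have : u ≤ √u := Real.le_sqrt_of_sq_le (by nlinarith)
    linarith
  · have : 1 ≤ √u := Real.one_le_sqrt.2 h
    linarith

/-- comparison of the Gaussian overlap, `w ≤ v`. -/
lemma overlap {v w d : ℝ} (hw : 0 < w) (hwv : w ≤ v) :
    heatKer (2 * v) 0 + heatKer (2 * w) 0 - 2 * heatKer (v + w) d ≤
      (1 / √w - 1 / √v) + min (1 / √w) (|d| / (2 * v) * 2) := by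
  have hp := Real.pi_pos
  have hp3 := Real.pi_gt_three
  have hv : 0 < v := by linarith
  have hS : 0 < v + w := by linarith
  have hsp : 1 ≤ √Real.pi := Real.one_le_sqrt.2 (by linarith)
  set u := d ^ 2 / (2 * (v + w)) with hu
  have hu0 : 0 ≤ u := by positivity
  have hE := one_sub_exp_le hu0
  have hE0 : 0 ≤ 1 - Real.exp (-u) := by
    have : Real.exp (-u) ≤ 1 := Real.exp_le_one_iff.2 (by linarith)
    linarith
  have e : heatKer (v + w) d = 1 / √(2 * Real.pi * (v + w)) * Real.exp (-u) := by
    rw [hk_pos_def hS, hu, neg_div]; ring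
  set c := 1 / √(2 * Real.pi * (v + w)) with hc
  have hc0 : 0 ≤ c := by positivity
  have hc1 : 1 / (2 * √Real.pi) * (1 / √v) ≤ c := by
    rw [hc, div_mul_div_comm, one_mul]
    apply one_div_le_one_div_of_le (by positivity)
    apply Real.sqrt_le_iff.2 ⟨by positivity, ?_⟩
    rw [mul_pow, mul_pow, Real.sq_sqrt hp.le, Real.sq_sqrt hv.le]
    nlinarith
  have hc2 : c ≤ 1 / 2 * (1 / √w) := by
    rw [hc, div_mul_div_comm, one_mul]
    apply one_div_le_one_div_of_le (by positivity)
    apply Real.le_sqrt_of_sq_le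
    rw [mul_pow, Real.sq_sqrt hw.le]
    nlinarith
  have hc3 : 2 * c * √u ≤ |d| / (2 * v) * 2 := by
    have : √u = |d| / √(2 * (v + w)) := by
      rw [hu, Real.sqrt_div (sq_nonneg d), Real.sqrt_sq_eq_abs]
    rw [this, hc]
    have h3 : c ≤ 1 / √(2 * (v + w)) := by
      rw [hc]
      apply one_div_le_one_div_of_le (by positivity)
      apply Real.sqrt_le_sqrt
      nlinarith
    have h4 : √(2 * (v + w)) * √(2 * (v + w)) = 2 * (v + w) := Real.mul_self_sqrt (by positivity)
    calc 2 * c * (|d| / √(2 * (v + w))) ≤ 2 * (1 / √(2 * (v + w))) * (|d| / √(2 * (v + w))) := by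
          gcongr
      _ = 2 * (|d| / (√(2 * (v + w)) * √(2 * (v + w)))) := by ring
      _ = 2 * (|d| / (2 * (v + w))) := by rw [h4]
      _ ≤ 2 * (|d| / (2 * v)) := by gcongr; linarith
      _ = _ := by ring
  have hA : 1 / (2 * √Real.pi) * (1 / √w - 1 / √v) ≤ 1 / √w - 1 / √v := by
    have : 1 / √v ≤ 1 / √w := one_div_le_one_div_of_le (by positivity) (Real.sqrt_le_sqrt hwv)
    have h5 : 1 / (2 * √Real.pi) ≤ 1 := by
      rw [div_le_one (by positivity)]; linarith
    nlinarith
  have hB : 2 * c * (1 - Real.exp (-u)) ≤ min (1 / √w) (|d| / (2 * v) * 2) := by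
    refine le_min ?_ ?_
    · have := hE.trans (min_le_left _ _)
      nlinarith
    · refine le_trans ?_ hc3
      have := hE.trans (min_le_right _ _)
      gcongr
  rw [hk_zero hv, hk_zero hw, e]
  linarith

lemma inv_sqrt_eq {s r : ℝ} (hr : 0 < r) (hs : r < s) :
    1 / √(r * (s - r) / s) = √(1 / r + 1 / (s - r)) := by
  have h1 : 0 < s - r := by linarith
  have h2 : 0 < s := by linarith
  rw [one_div, ← Real.sqrt_inv]
  congr 1
  field_simp
  ring

lemma sqrt_diff {c p q : ℝ} (hc : 0 ≤ c) (hq : 0 ≤ q) (hpq : q ≤ p) :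
    √(c + p) - √(c + q) ≤ √p - √q := by
  have h1 : √(c + p) ≤ √(c + q) + (√p - √q) := by
    have hs : √q ≤ √p := Real.sqrt_le_sqrt hpq
    apply Real.sqrt_le_iff.2 ⟨by have := Real.sqrt_nonneg (c+q); linarith, ?_⟩
    have e1 := Real.sq_sqrt (show 0 ≤ c + q by linarith)
    have e2 := Real.sq_sqrt hq
    have e3 := Real.sq_sqrt (hq.trans hpq)
    have h4 : √q ≤ √(c + q) := Real.sqrt_le_sqrt (by linarith)
    nlinarith
  linarith

lemma pointwise {t h r : ℝ} (hr : 0 < r) (hrt : r < t) (hh : 0 < h) (x : ℝ) :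
    ∫ z : ℝ, (heatKer (t + h - r) (x - z) * heatKer r z / heatKer (t + h) x -
          heatKer (t - r) (x - z) * heatKer r z / heatKer t x) ^ 2 ≤
    (1 / √(t - r) - 1 / √(t + h - r)) +
      min (1 / √r + 1 / √(t - r)) (|x| * √h / (2 * t) * (1 / √(t - r))) := by
  have ht : 0 < t := by linarith
  have h1 : 0 < t - r := by linarith
  have h2 : 0 < t + h - r := by linarith
  rw [inner_eq hr hrt hh]
  set w := r * (t - r) / t with hw
  set v := r * (t + h - r) / (t + h) with hv
  have hw0 : 0 < w := by positivity
  have hv0 : 0 < v := by positivity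
  have hwv : w ≤ v := by
    rw [hw, hv, div_le_div_iff₀ ht (by positivity)]
    nlinarith [mul_pos (mul_pos hr hr) hh]
  refine (overlap hw0 hwv).trans ?_
  have ew : 1 / √w = √(1 / r + 1 / (t - r)) := inv_sqrt_eq hr hrt
  have ev : 1 / √v = √(1 / r + 1 / (t + h - r)) := inv_sqrt_eq hr (by linarith)
  have hs (a : ℝ) : √(1 / a) = 1 / √a := by rw [one_div, Real.sqrt_inv, one_div]
  apply add_le_add
  · rw [ew, ev, ← hs, ← hs]
    exact sqrt_diff (by positivity) (by positivity)
      (one_div_le_one_div_of_le h1 (by linarith))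
  · apply min_le_min
    · rw [ew, ← hs, ← hs]
      apply Real.sqrt_le_iff.2 ⟨by positivity, ?_⟩
      have e1 := Real.sq_sqrt (show 0 ≤ 1 / r by positivity)
      have e2 := Real.sq_sqrt (show 0 ≤ 1 / (t - r) by positivity)
      have : 0 ≤ √(1 / r) * √(1 / (t - r)) := by positivity
      nlinarith
    · have e : x * r / (t + h) - x * r / t = -(x * (r * h / (t * (t + h)))) := by
        field_simp
        ring
      have e1 : |x * r / (t + h) - x * r / t| / (2 * v) * 2 = |x| * h / (t * (t + h - r)) := by
        rw [e, abs_neg, abs_mul, abs_of_pos (show 0 < r * h / (t * (t + h)) by positivity), hv]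
        field_simp
      rw [e1]
      have a1 := Real.sq_sqrt hh.le
      have a2 := Real.sq_sqrt h1.le
      have a3 : 0 < √h := Real.sqrt_pos.2 hh
      have a4 : 0 < √(t - r) := Real.sqrt_pos.2 h1
      rw [div_mul_div_comm, div_le_div_iff₀ (by positivity) (by positivity)]
      have : 2 * (√h * √(t - r)) ≤ t + h - r := by nlinarith [sq_nonneg (√h - √(t - r))]
      calc |x| * h * (2 * t * √(t - r)) = |x| * √h * t * (2 * (√h * √(t - r))) := by
            nth_rewrite 1 [← a1]; ring
        _ ≤ |x| * √h * t * (t + h - r) := by gcongr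
        _ = _ := by ring

lemma int0 (a b : ℝ) (ha : 0 ≤ a) (hb : 0 ≤ b) :
    IntervalIntegrable (fun r : ℝ => 1 / √r) volume a b ∧
    ∫ r in a..b, 1 / √r = 2 * √b - 2 * √a := by
  have e : Set.EqOn (fun r : ℝ => r ^ (-(1/2) : ℝ)) (fun r => 1 / √r) (Set.uIcc a b) := by
    intro r hr
    have : 0 ≤ r := (le_min ha hb).trans hr.1
    simp only
    rw [Real.rpow_neg this, Real.sqrt_eq_rpow, one_div, one_div]
  constructor
  · exact (intervalIntegral.intervalIntegrable_rpow' (a := a) (b := b)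
      (r := -(1/2)) (by norm_num)).congr (fun r hr => e (Set.uIoc_subset_uIcc hr))
  · rw [← intervalIntegral.integral_congr e, integral_rpow (Or.inl (by norm_num)),
      Real.sqrt_eq_rpow, Real.sqrt_eq_rpow]
    norm_num
    ring

lemma int1 (s t : ℝ) (ht : 0 ≤ t) (hs : t ≤ s) :
    IntervalIntegrable (fun r : ℝ => 1 / √(s - r)) volume 0 t ∧
    ∫ r in (0:ℝ)..t, 1 / √(s - r) = 2 * √s - 2 * √(s - t) := by
  have h := int0 (s - t) s (by linarith) (by linarith)
  constructor
  · have := (h.1.comp_sub_left s).symm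
    simpa using this
  · rw [intervalIntegral.integral_comp_sub_left (fun r => 1 / √r) s, sub_zero, h.2]

lemma int_le {t : ℝ} (ht : 0 < t) {f g : ℝ → ℝ} (hf : ∀ r, 0 ≤ f r)
    (hg : IntervalIntegrable g volume 0 t) (hfg : ∀ r, 0 < r → r < t → f r ≤ g r) :
    ∫ r in (0:ℝ)..t, f r ≤ ∫ r in (0:ℝ)..t, g r := by
  rw [intervalIntegral.integral_of_le ht.le, intervalIntegral.integral_of_le ht.le,
    integral_Ioc_eq_integral_Ioo, integral_Ioc_eq_integral_Ioo]
  apply integral_mono_of_nonneg (Filter.Eventually.of_forall hf)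
  · exact ((intervalIntegrable_iff_integrableOn_Ioo_of_le ht.le).1 hg)
  · filter_upwards [ae_restrict_mem measurableSet_Ioo] with r hr
    exact hfg r hr.1 hr.2

lemma main_bounds {t h : ℝ} (ht : 0 < t) (hh : 0 < h) (x : ℝ) :
    (∫ r in (0:ℝ)..t, ∫ z : ℝ,
        (heatKer (t + h - r) (x - z) * heatKer r z / heatKer (t + h) x -
          heatKer (t - r) (x - z) * heatKer r z / heatKer t x) ^ 2) ≤ 2 * √h + 4 * √t ∧
    (∫ r in (0:ℝ)..t, ∫ z : ℝ,
        (heatKer (t + h - r) (x - z) * heatKer r z / heatKer (t + h) x -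
          heatKer (t - r) (x - z) * heatKer r z / heatKer t x) ^ 2) ≤
        2 * √h + |x| * √h / √t := by
  obtain ⟨i0, e0⟩ := int0 0 t le_rfl ht.le
  obtain ⟨i1, e1⟩ := int1 t t ht.le le_rfl
  obtain ⟨i2, e2⟩ := int1 (t + h) t ht.le (by linarith)
  have hs : √t ≤ √(t + h) := Real.sqrt_le_sqrt (by linarith)
  have hth : t + h - t = h := by ring
  simp only [Real.sqrt_zero, sub_self, mul_zero, sub_zero, hth] at e0 e1 e2
  constructor
  · refine (int_le ht (fun r => integral_nonneg fun z => sq_nonneg _)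
      ((i1.sub i2).add (i0.add i1)) (fun r h1 h2 => (pointwise h1 h2 hh x).trans
        (add_le_add le_rfl (min_le_left _ _)))).trans ?_
    rw [intervalIntegral.integral_add (i1.sub i2) (i0.add i1),
      intervalIntegral.integral_sub i1 i2, intervalIntegral.integral_add i0 i1, e0, e1, e2]
    linarith
  · refine (int_le ht (fun r => integral_nonneg fun z => sq_nonneg _)
      ((i1.sub i2).add (i1.const_mul (|x| * √h / (2 * t)))) (fun r h1 h2 =>
        (pointwise h1 h2 hh x).trans (add_le_add le_rfl (min_le_right _ _)))).trans ?_
    rw [intervalIntegral.integral_add (i1.sub i2) (i1.const_mul _),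
      intervalIntegral.integral_sub i1 i2, intervalIntegral.integral_const_mul, e1, e2]
    have : |x| * √h / (2 * t) * (2 * √t) = |x| * √h / √t := by
      have h1 := Real.sqrt_pos.2 ht
      have h2 := Real.mul_self_sqrt ht.le
      rw [div_mul_eq_mul_div, div_eq_div_iff (by positivity) (by positivity)]
      nth_rewrite 3 [← h2]
      ring
    linarith

/-- Proposition C.10 (prop:nogap): for `T > 1`, `K > 1`, `t ∈ (0,T]`, `x ∈ [−K,K]`,
`h ∈ (0,1]`, with
`F(r,z) = ρ(t+h−r,x−z) ρ(r,z)/ρ(t+h,x) − ρ(t−r,x−z) ρ(r,z)/ρ(t,x)`: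
(i) `∫₀ᵗ ∫_ℝ F² dz dr ≤ 10 T^{3/2} K² h^{1/7}`; and
(ii) if moreover `δ ∈ (0,1)`, `t ≥ δ` and `t + h ≤ T`, then
`∫₀ᵗ ∫_ℝ F² dz dr ≤ (10/δ³) T^{3/2} K² √h`. -/
theorem stmt9 (T K t x h : ℝ) (hT : 1 < T) (hK : 1 < K) (ht0 : 0 < t) (htT : t ≤ T)
    (hx : x ∈ Set.Icc (-K) K) (hh0 : 0 < h) (hh1 : h ≤ 1) :
    (∫ r in (0:ℝ)..t, ∫ z : ℝ,
        (heatKer (t + h - r) (x - z) * heatKer r z / heatKer (t + h) x -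
          heatKer (t - r) (x - z) * heatKer r z / heatKer t x) ^ 2) ≤
      10 * T ^ ((3:ℝ)/2) * K ^ 2 * h ^ ((1:ℝ)/7) ∧
    (∀ δ : ℝ, 0 < δ → δ < 1 → δ ≤ t → t + h ≤ T →
      (∫ r in (0:ℝ)..t, ∫ z : ℝ,
          (heatKer (t + h - r) (x - z) * heatKer r z / heatKer (t + h) x -
            heatKer (t - r) (x - z) * heatKer r z / heatKer t x) ^ 2) ≤
        10 / δ ^ 3 * T ^ ((3:ℝ)/2) * K ^ 2 * Real.sqrt h) := by
  have hx' : |x| ≤ K := abs_le.2 hx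
  obtain ⟨b1, b2⟩ := main_bounds ht0 hh0 x
  have hT1 : 1 ≤ T ^ ((3:ℝ)/2) := Real.one_le_rpow hT.le (by norm_num)
  have hK1 : K ≤ K ^ 2 := by nlinarith
  have hTK : K ≤ T ^ ((3:ℝ)/2) * K ^ 2 := by nlinarith
  have hsh : 0 < √h := Real.sqrt_pos.2 hh0
  have hst : 0 < √t := Real.sqrt_pos.2 ht0
  constructor
  · set y := h ^ ((1:ℝ)/4) with hy
    have hy0 : 0 < y := Real.rpow_pos_of_pos hh0 _
    have hy2 : √h = y * y := by
      rw [Real.sqrt_eq_rpow, hy, ← Real.rpow_add hh0]; norm_num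
    have hy1 : y ≤ 1 := Real.rpow_le_one hh0.le hh1 (by norm_num)
    have hyy : y ≤ h ^ ((1:ℝ)/7) :=
      Real.rpow_le_rpow_of_exponent_ge hh0 hh1 (by norm_num)
    have hsy : √h ≤ y := by rw [hy2]; nlinarith
    have key : (6 * K) * y ≤ 10 * T ^ ((3:ℝ)/2) * K ^ 2 * h ^ ((1:ℝ)/7) := by
      have : 6 * K ≤ 10 * T ^ ((3:ℝ)/2) * K ^ 2 := by linarith
      gcongr
    refine le_trans ?_ key
    rcases le_total (√t) y with hc | hc
    · refine b1.trans ?_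
      nlinarith
    · refine b2.trans ?_
      have : |x| * √h / √t ≤ K * y := by
        rw [div_le_iff₀ hst, hy2]
        calc |x| * (y * y) ≤ K * (y * √t) := by gcongr
          _ = _ := by ring
      nlinarith
  · intro δ hδ0 hδ1 hδt _
    refine b2.trans ?_
    have hd : δ ^ 3 ≤ √t := by
      apply Real.le_sqrt_of_sq_le
      calc (δ ^ 3) ^ 2 = δ * δ ^ 5 := by ring
        _ ≤ δ * 1 := by gcongr; exact pow_le_one₀ hδ0.le hδ1.le
        _ ≤ t := by linarith
    have hd1 : δ ^ 3 ≤ 1 := pow_le_one₀ hδ0.le hδ1.le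
    have hd0 : 0 < δ ^ 3 := by positivity
    have h1 : |x| * √h / √t ≤ K * √h / δ ^ 3 := by gcongr
    have h2 : 2 * √h ≤ 2 * K * √h / δ ^ 3 := by
      rw [le_div_iff₀ hd0]
      calc 2 * √h * δ ^ 3 ≤ 2 * √h * 1 := by gcongr
        _ ≤ 2 * K * √h := by nlinarith
    calc _ ≤ 2 * K * √h / δ ^ 3 + K * √h / δ ^ 3 := add_le_add h2 h1
      _ = 3 * K * (√h / δ ^ 3) := by ring
      _ ≤ 10 * (T ^ ((3:ℝ)/2) * K ^ 2) * (√h / δ ^ 3) := by gcongr; linarith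
      _ = _ := by ring
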